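/- arXiv:2404.03151 — 2 statements merged into one kernel-verified Lean document; each statement's English description precedes it below -/
import Mathlib

section
/- Let G be a simple connected graph on n vertices and let A be a real symmetric n×n matrix satisfying the Nodal Count Condition for G (A is strictly supported on G, has simple eigenvalues λ_1<…<λ_n, and every eigenvector φ_k is nowhere-vanishing). Then the total nodal surplus is bounded above: Σ_{k=1}^{n} [ν(A,φ_k) − (k−1)] ≤ n·β(G) − β(G). -/
open Matrix

/-- A matrix is supported on a simple graph `G` if its off-diagonal entries vanish
outside the edges of `G`. -/
def SupportedOn {V : Type*} (G : SimpleGraph V) (A : Matrix V V ℝ) : Prop :=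
  ∀ i j, i ≠ j → ¬ G.Adj i j → A i j = 0

/-- The nodal (edge sign-change) count of a vector `φ` with respect to a matrix `A`:
the number of pairs `i < j` with `A i j * φ i * φ j > 0`. -/
noncomputable def nodalCount {n : ℕ} (A : Matrix (Fin n) (Fin n) ℝ) (φ : Fin n → ℝ) : ℕ :=
  Nat.card {p : Fin n × Fin n // p.1 < p.2 ∧ 0 < A p.1 p.2 * φ p.1 * φ p.2}

/-- The first Betti number of a graph on `n` vertices: `|E(G)| - (n - 1)`. -/
noncomputable def betti {n : ℕ} (G : SimpleGraph (Fin n)) : ℕ :=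
  Nat.card G.edgeSet - (n - 1)

/-- Codimensions are subadditive under finite intersections. -/
theorem sum_finrank_add_finrank_le {V ι : Type*} [AddCommGroup V] [Module ℝ V]
    [FiniteDimensional ℝ V] (S : ι → Submodule ℝ V) (s : Finset ι) :
    ∑ k ∈ s, Module.finrank ℝ (S k) + Module.finrank ℝ V ≤
      Module.finrank ℝ (s.inf S : Submodule ℝ V) + s.card * Module.finrank ℝ V := by
  classical
  induction s using Finset.induction_on with
  | empty => rw [Finset.inf_empty, finrank_top]; simp
  | insert a s ha ih =>
    rw [Finset.sum_insert ha, Finset.card_insert_of_notMem ha, Finset.inf_insert]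
    have h1 := Submodule.finrank_sup_add_finrank_inf_eq (S a) (s.inf S)
    have h2 := Submodule.finrank_le (S a ⊔ s.inf S)
    rw [add_mul]
    lia

/-- If functions `q k` vanishing at `0` and invariant under translation by `R` sum to zero, and
each `q k` is negative on `N k \ {0}`, then the dimensions of the `N k` add up to at most
`(#ι - 1) * (dim V - dim R)`. -/
theorem sum_finrank_negative_add_le {V ι : Type*} [AddCommGroup V] [Module ℝ V]
    [FiniteDimensional ℝ V] [Fintype ι] [Nonempty ι] (q : ι → V → ℝ) (R : Submodule ℝ V)
    (N : ι → Submodule ℝ V) (hq0 : ∀ k, q k 0 = 0)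
    (hR : ∀ k a, ∀ b ∈ R, q k (a + b) = q k a)
    (hN : ∀ k, ∀ a ∈ N k, a ≠ 0 → q k a < 0) (hsum : ∀ a, ∑ k, q k a = 0) :
    ∑ k, Module.finrank ℝ (N k) + Fintype.card ι * Module.finrank ℝ R + Module.finrank ℝ V ≤
      Module.finrank ℝ R + Fintype.card ι * Module.finrank ℝ V := by
  classical
  have hdisj : ∀ k, N k ⊓ R = ⊥ := by
    intro k
    rw [eq_bot_iff]
    rintro a ⟨ha, hb⟩
    by_contra h0
    have h1 := hN k a ha h0
    have h2 := hR k 0 a hb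
    rw [zero_add, hq0] at h2
    linarith
  have hdim : ∀ k, Module.finrank ℝ (N k ⊔ R : Submodule ℝ V) =
      Module.finrank ℝ (N k) + Module.finrank ℝ R := by
    intro k
    have h := Submodule.finrank_sup_add_finrank_inf_eq (N k) R
    rwa [hdisj, finrank_bot, add_zero] at h
  have hle : Finset.univ.inf (fun k => N k ⊔ R) ≤ R := by
    intro v hv
    rw [Submodule.mem_finsetInf] at hv
    have hex : ∀ k, ∃ a ∈ N k, ∃ b ∈ R, a + b = v := fun k =>
      Submodule.mem_sup.1 (hv k (Finset.mem_univ k))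
    choose a ha b hb hab using hex
    have hqa : ∀ k, q k v = q k (a k) := fun k => by rw [← hab k, hR k _ _ (hb k)]
    have hnonpos : ∀ k ∈ Finset.univ, q k v ≤ 0 := by
      intro k _
      rw [hqa]
      by_cases h0 : a k = 0
      · rw [h0, hq0]
      · exact (hN k _ (ha k) h0).le
    have hzero := (Finset.sum_eq_zero_iff_of_nonpos hnonpos).1 (hsum v)
    obtain ⟨k⟩ := ‹Nonempty ι›
    have hak : a k = 0 := by
      by_contra h0
      have h1 := hN k _ (ha k) h0
      have h2 := hzero k (Finset.mem_univ k)
      rw [hqa] at h2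
      linarith
    rw [← hab k, hak, zero_add]
    exact hb k
  have h1 := sum_finrank_add_finrank_le (fun k => N k ⊔ R) Finset.univ
  have h2 := Submodule.finrank_mono hle
  simp only [hdim, Finset.sum_add_distrib, Finset.sum_const, smul_eq_mul, Finset.card_univ] at h1
  lia

namespace SimpleGraph

variable {n : ℕ}

/-- The edges of `G`, oriented from the smaller to the larger endpoint. -/
abbrev OrientedEdge (G : SimpleGraph (Fin n)) : Type :=
  {p : Fin n × Fin n // p.1 < p.2 ∧ G.Adj p.1 p.2}

noncomputable instance (G : SimpleGraph (Fin n)) : Fintype G.OrientedEdge :=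
  Fintype.ofFinite _

theorem card_orientedEdge (G : SimpleGraph (Fin n)) :
    Fintype.card G.OrientedEdge = Nat.card G.edgeSet := by
  rw [← Nat.card_eq_fintype_card]
  refine Nat.card_congr (Equiv.ofBijective
    (fun e => (⟨s(e.1.1, e.1.2), e.2.2⟩ : G.edgeSet)) ⟨?_, ?_⟩)
  · rintro ⟨⟨i, j⟩, hij, hadj⟩ ⟨⟨i', j'⟩, hij', hadj'⟩ h
    replace h := Sym2.eq_iff.1 (congrArg Subtype.val h)
    simp only [Subtype.mk.injEq, Prod.mk.injEq]
    simp only at hij hij'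
    rcases h with h | ⟨rfl, rfl⟩
    · exact h
    · exact absurd hij (not_lt.2 hij'.le)
  · rintro ⟨e, he⟩
    induction e using Sym2.ind with
    | h i j =>
      rw [mem_edgeSet] at he
      rcases lt_or_gt_of_ne he.ne with h | h
      · exact ⟨⟨(i, j), h, he⟩, rfl⟩
      · exact ⟨⟨(j, i), h, he.symm⟩, Subtype.ext Sym2.eq_swap⟩

/-- A double sum supported on the edges, as a sum over oriented edges. -/
theorem sum_sum_eq_sum_orientedEdge (G : SimpleGraph (Fin n)) (f : Fin n → Fin n → ℝ)
    (hf : ∀ i j, ¬ G.Adj i j → f i j = 0) :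
    ∑ i, ∑ j, f i j = ∑ e : G.OrientedEdge, (f e.1.1 e.1.2 + f e.1.2 e.1.1) := by
  classical
  have hE : ∀ g : Fin n → Fin n → ℝ, (∀ i j, ¬ G.Adj i j → g i j = 0) →
      ∑ e : G.OrientedEdge, g e.1.1 e.1.2 = ∑ i, ∑ j, if i < j then g i j else 0 := by
    intro g hg
    rw [← Finset.sum_product', Finset.univ_product_univ, ← Finset.sum_filter]
    rw [← Finset.sum_subset
      (s₁ := Finset.univ.filter fun p : Fin n × Fin n => p.1 < p.2 ∧ G.Adj p.1 p.2)]
    · exact (Finset.sum_subtype _ (by simp) fun p : Fin n × Fin n => g p.1 p.2).symm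
    · intro p
      simp only [Finset.mem_filter]
      tauto
    · intro p hp hp'
      refine hg _ _ fun h => hp' ?_
      simp only [Finset.mem_filter] at hp ⊢
      exact ⟨hp.1, hp.2, h⟩
  rw [Finset.sum_add_distrib, hE f hf,
    hE (fun i j => f j i) (fun i j h => hf j i fun h' => h h'.symm),
    Finset.sum_comm (f := fun i j => if i < j then f j i else 0),
    ← Finset.sum_add_distrib]
  refine Finset.sum_congr rfl fun i _ => ?_
  rw [← Finset.sum_add_distrib]
  refine Finset.sum_congr rfl fun j _ => ?_
  rcases lt_trichotomy i j with h | rfl | h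
  · simp [h, h.not_gt]
  · simp [hf i i (G.irrefl)]
  · simp [h, h.not_gt]

/-- The coboundary map from functions on vertices to functions on oriented edges. -/
def coboundary (G : SimpleGraph (Fin n)) : (Fin n → ℝ) →ₗ[ℝ] (G.OrientedEdge → ℝ) where
  toFun x e := x e.1.1 - x e.1.2
  map_add' x y := by ext e; simp only [Pi.add_apply]; ring
  map_smul' c x := by ext e; simp only [Pi.smul_apply, smul_eq_mul, RingHom.id_apply]; ring

theorem finrank_range_coboundary_add_one {G : SimpleGraph (Fin n)} (hG : G.Connected) :
    Module.finrank ℝ (LinearMap.range G.coboundary) + 1 = n := by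
  have hker : LinearMap.ker G.coboundary = Submodule.span ℝ {fun _ => (1 : ℝ)} := by
    ext x
    rw [LinearMap.mem_ker, Submodule.mem_span_singleton]
    constructor
    · intro hx
      have hadj : ∀ i j, G.Adj i j → x i = x j := by
        intro i j h
        rcases lt_or_gt_of_ne h.ne with h' | h'
        · exact sub_eq_zero.1 (congrFun hx ⟨(i, j), h', h⟩)
        · exact (sub_eq_zero.1 (congrFun hx ⟨(j, i), h', h.symm⟩)).symm
      have hwalk : ∀ i j, G.Walk i j → x i = x j := by
        intro i j w
        induction w with
        | nil => rfl
        | cons h _ ih => exact (hadj _ _ h).trans ih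
      obtain ⟨i⟩ := hG.nonempty
      refine ⟨x i, funext fun j => ?_⟩
      obtain ⟨w⟩ := hG.preconnected i j
      simp [hwalk i j w]
    · rintro ⟨c, rfl⟩
      ext e
      simp [coboundary]
  have h1 : Module.finrank ℝ (LinearMap.ker G.coboundary) = 1 := by
    rw [hker]
    obtain ⟨i⟩ := hG.nonempty
    exact finrank_span_singleton fun h => one_ne_zero (congrFun h i)
  have h := LinearMap.finrank_range_add_finrank_ker G.coboundary
  rwa [h1, Module.finrank_fin_fun] at h

variable (G : SimpleGraph (Fin n)) (A : Matrix (Fin n) (Fin n) ℝ) (lam : Fin n → ℝ)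
  (φ : Fin n → Fin n → ℝ)

/-- The functional `α ↦ φ l ⬝ B φ k`, where `B` is the antisymmetric matrix with entries
`A i j * α (i, j)` for `i < j`. -/
noncomputable def fluxCoupling (k l : Fin n) : (G.OrientedEdge → ℝ) →ₗ[ℝ] ℝ :=
  ∑ e : G.OrientedEdge,
    (A e.1.1 e.1.2 * (φ l e.1.1 * φ k e.1.2 - φ l e.1.2 * φ k e.1.1)) • LinearMap.proj e

theorem fluxCoupling_apply (k l : Fin n) (α : G.OrientedEdge → ℝ) :
    G.fluxCoupling A φ k l α = ∑ e : G.OrientedEdge,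
      A e.1.1 e.1.2 * (φ l e.1.1 * φ k e.1.2 - φ l e.1.2 * φ k e.1.1) * α e := by
  simp [fluxCoupling]

theorem fluxCoupling_swap (k l : Fin n) (α : G.OrientedEdge → ℝ) :
    G.fluxCoupling A φ l k α = -G.fluxCoupling A φ k l α := by
  rw [fluxCoupling_apply, fluxCoupling_apply, ← Finset.sum_neg_distrib]
  exact Finset.sum_congr rfl fun e _ => by ring

theorem fluxCoupling_self (k : Fin n) (α : G.OrientedEdge → ℝ) :
    G.fluxCoupling A φ k k α = 0 := by
  have h := G.fluxCoupling_swap A φ k k α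
  linarith

/-- Half the polarized Hessian of the `k`-th eigenvalue under magnetic perturbations. -/
noncomputable def fluxHessian (k : Fin n) (α γ : G.OrientedEdge → ℝ) : ℝ :=
  -∑ e : G.OrientedEdge, A e.1.1 e.1.2 * φ k e.1.1 * φ k e.1.2 * (α e * γ e) +
    ∑ l, G.fluxCoupling A φ k l α * G.fluxCoupling A φ k l γ / (lam k - lam l)

theorem fluxHessian_add_self (k : Fin n) (α γ : G.OrientedEdge → ℝ) :
    G.fluxHessian A lam φ k (α + γ) (α + γ) = G.fluxHessian A lam φ k α α +
      2 * G.fluxHessian A lam φ k α γ + G.fluxHessian A lam φ k γ γ := by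
  have h1 : ∑ e : G.OrientedEdge,
      A e.1.1 e.1.2 * φ k e.1.1 * φ k e.1.2 * ((α + γ) e * (α + γ) e) =
      ∑ e : G.OrientedEdge, A e.1.1 e.1.2 * φ k e.1.1 * φ k e.1.2 * (α e * α e) +
      2 * ∑ e : G.OrientedEdge, A e.1.1 e.1.2 * φ k e.1.1 * φ k e.1.2 * (α e * γ e) +
      ∑ e : G.OrientedEdge, A e.1.1 e.1.2 * φ k e.1.1 * φ k e.1.2 * (γ e * γ e) := by
    rw [Finset.mul_sum, ← Finset.sum_add_distrib, ← Finset.sum_add_distrib]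
    exact Finset.sum_congr rfl fun e _ => by simp only [Pi.add_apply]; ring
  have h2 : ∑ l, G.fluxCoupling A φ k l (α + γ) * G.fluxCoupling A φ k l (α + γ) /
        (lam k - lam l) =
      ∑ l, G.fluxCoupling A φ k l α * G.fluxCoupling A φ k l α / (lam k - lam l) +
      2 * ∑ l, G.fluxCoupling A φ k l α * G.fluxCoupling A φ k l γ / (lam k - lam l) +
      ∑ l, G.fluxCoupling A φ k l γ * G.fluxCoupling A φ k l γ / (lam k - lam l) := by
    rw [Finset.mul_sum, ← Finset.sum_add_distrib, ← Finset.sum_add_distrib]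
    exact Finset.sum_congr rfl fun l _ => by rw [map_add]; ring
  simp only [fluxHessian]
  rw [h1, h2]
  ring

theorem sum_fluxHessian_self
    (hcomplete : ∀ i j, i ≠ j → ∑ k, φ k i * φ k j = 0) (α : G.OrientedEdge → ℝ) :
    ∑ k, G.fluxHessian A lam φ k α α = 0 := by
  have h1 : ∑ k, ∑ e : G.OrientedEdge,
      A e.1.1 e.1.2 * φ k e.1.1 * φ k e.1.2 * (α e * α e) = 0 := by
    rw [Finset.sum_comm]
    refine Finset.sum_eq_zero fun e _ => ?_
    have h := hcomplete e.1.1 e.1.2 e.2.2.ne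
    calc _ = A e.1.1 e.1.2 * (α e * α e) * ∑ k, φ k e.1.1 * φ k e.1.2 := by
          rw [Finset.mul_sum]
          exact Finset.sum_congr rfl fun k _ => by ring
      _ = 0 := by rw [h, mul_zero]
  have h2 : ∑ k, ∑ l,
      G.fluxCoupling A φ k l α * G.fluxCoupling A φ k l α / (lam k - lam l) = 0 := by
    have h : ∑ k, ∑ l,
        G.fluxCoupling A φ k l α * G.fluxCoupling A φ k l α / (lam k - lam l) =
        -∑ k, ∑ l,
        G.fluxCoupling A φ k l α * G.fluxCoupling A φ k l α / (lam k - lam l) := by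
      conv_lhs => rw [Finset.sum_comm]
      rw [← Finset.sum_neg_distrib]
      refine Finset.sum_congr rfl fun k _ => ?_
      rw [← Finset.sum_neg_distrib]
      refine Finset.sum_congr rfl fun l _ => ?_
      rw [G.fluxCoupling_swap A φ k l, neg_mul_neg, ← neg_sub (lam k) (lam l), div_neg]
    linarith
  simp only [fluxHessian, Finset.sum_add_distrib, Finset.sum_neg_distrib]
  rw [h1, h2]
  ring

variable {G A lam φ}

theorem fluxCoupling_coboundary (hA : A.IsSymm) (hsupp : SupportedOn G A)
    (heig : ∀ k, A.mulVec (φ k) = lam k • φ k) (k l : Fin n) (x : Fin n → ℝ) :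
    G.fluxCoupling A φ k l (G.coboundary x) =
      (lam k - lam l) * ∑ i, x i * φ l i * φ k i := by
  have hev : ∀ k i, ∑ j, A i j * φ k j = lam k * φ k i := fun k i => congrFun (heig k) i
  have h := G.sum_sum_eq_sum_orientedEdge (fun i j => A i j * (x i - x j) * φ l i * φ k j) (by
    intro i j hij
    by_cases h : i = j
    · simp [h]
    · simp [hsupp i j h hij])
  rw [fluxCoupling_apply]
  trans ∑ i, ∑ j, A i j * (x i - x j) * φ l i * φ k j
  · rw [h]
    refine Finset.sum_congr rfl fun e _ => ?_
    rw [hA.apply e.1.1 e.1.2]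
    simp only [coboundary, LinearMap.coe_mk, AddHom.coe_mk]
    ring
  · have h1 : ∑ i, ∑ j, A i j * (x i - x j) * φ l i * φ k j =
        ∑ i, x i * φ l i * ∑ j, A i j * φ k j - ∑ i, ∑ j, x j * φ k j * (A j i * φ l i) := by
      rw [← Finset.sum_sub_distrib]
      refine Finset.sum_congr rfl fun i _ => ?_
      rw [Finset.mul_sum, ← Finset.sum_sub_distrib]
      refine Finset.sum_congr rfl fun j _ => ?_
      rw [hA.apply i j]
      ring
    rw [h1, Finset.sum_comm (f := fun i j => x j * φ k j * (A j i * φ l i))]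
    simp only [← Finset.mul_sum, hev]
    rw [← Finset.sum_sub_distrib, Finset.mul_sum]
    exact Finset.sum_congr rfl fun i _ => by ring

theorem fluxHessian_coboundary (hA : A.IsSymm) (hsupp : SupportedOn G A)
    (hlam : Function.Injective lam) (heig : ∀ k, A.mulVec (φ k) = lam k • φ k)
    (hcomplete : ∀ i j, ∑ k, φ k i * φ k j = if i = j then 1 else 0)
    (k : Fin n) (α : G.OrientedEdge → ℝ) (x : Fin n → ℝ) :
    G.fluxHessian A lam φ k α (G.coboundary x) = 0 := by
  have hterm : ∀ l, G.fluxCoupling A φ k l α * G.fluxCoupling A φ k l (G.coboundary x) /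
      (lam k - lam l) = G.fluxCoupling A φ k l α * ∑ i, x i * φ l i * φ k i := by
    intro l
    rw [fluxCoupling_coboundary hA hsupp heig]
    by_cases h : l = k
    · subst h
      simp [fluxCoupling_self]
    · have : lam k - lam l ≠ 0 := sub_ne_zero.2 fun h' => h (hlam h').symm
      field_simp
  have hproj : ∀ j, ∑ l, φ l j * ∑ i, x i * φ l i * φ k i = x j * φ k j := by
    intro j
    simp only [Finset.mul_sum]
    rw [Finset.sum_comm]
    calc _ = ∑ i, x i * φ k i * ∑ l, φ l i * φ l j := by
          refine Finset.sum_congr rfl fun i _ => ?_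
          rw [Finset.mul_sum]
          exact Finset.sum_congr rfl fun l _ => by ring
      _ = x j * φ k j := by simp [hcomplete]
  have hsum : ∑ l, G.fluxCoupling A φ k l α * ∑ i, x i * φ l i * φ k i =
      ∑ e : G.OrientedEdge,
        A e.1.1 e.1.2 * φ k e.1.1 * φ k e.1.2 * (α e * G.coboundary x e) := by
    simp only [fluxCoupling_apply, Finset.sum_mul]
    rw [Finset.sum_comm]
    refine Finset.sum_congr rfl fun e _ => ?_
    calc _ = A e.1.1 e.1.2 * α e *
          (φ k e.1.2 * ∑ l, φ l e.1.1 * ∑ i, x i * φ l i * φ k i -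
            φ k e.1.1 * ∑ l, φ l e.1.2 * ∑ i, x i * φ l i * φ k i) := by
          rw [Finset.mul_sum, Finset.mul_sum, ← Finset.sum_sub_distrib, Finset.mul_sum]
          exact Finset.sum_congr rfl fun l _ => by ring
      _ = _ := by
          rw [hproj, hproj]
          simp only [coboundary, LinearMap.coe_mk, AddHom.coe_mk]
          ring
  simp only [fluxHessian, hterm]
  rw [hsum]
  ring

/-- A subspace of dimension at least `nodalCount A (φ k) - k` on which the Hessian of the `k`-th
eigenvalue is negative definite. -/
theorem exists_fluxHessian_negative (hsupp : SupportedOn G A) (hlam : StrictMono lam)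
    (k : Fin n) : ∃ N : Submodule ℝ (G.OrientedEdge → ℝ),
      nodalCount A (φ k) ≤ Module.finrank ℝ N + k ∧
      ∀ α ∈ N, α ≠ 0 → G.fluxHessian A lam φ k α α < 0 := by
  classical
  let w : G.OrientedEdge → ℝ := fun e => A e.1.1 e.1.2 * φ k e.1.1 * φ k e.1.2
  let T : (G.OrientedEdge → ℝ) →ₗ[ℝ] ({e // ¬ 0 < w e} → ℝ) × ({l // l < k} → ℝ) :=
    (LinearMap.pi fun e => LinearMap.proj e.1).prod
      (LinearMap.pi fun l => G.fluxCoupling A φ k l.1)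
  have hcard : nodalCount A (φ k) = Fintype.card {e // 0 < w e} := by
    rw [nodalCount, ← Nat.card_eq_fintype_card]
    refine Nat.card_congr
      { toFun := fun p => ⟨⟨p.1, p.2.1, ?_⟩, p.2.2⟩
        invFun := fun e => ⟨e.1.1, e.1.2.1, e.2⟩
        left_inv := fun _ => rfl
        right_inv := fun _ => rfl }
    by_contra h
    have := p.2.2
    rw [hsupp _ _ p.2.1.ne h] at this
    simp at this
  refine ⟨LinearMap.ker T, ?_, ?_⟩
  · have h1 := LinearMap.finrank_range_add_finrank_ker T
    have h2 := Submodule.finrank_le (LinearMap.range T)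
    rw [Module.finrank_prod, Module.finrank_fintype_fun_eq_card,
      Module.finrank_fintype_fun_eq_card] at h2
    rw [Module.finrank_fintype_fun_eq_card] at h1
    have h3 := Fintype.card_subtype_compl fun e => 0 < w e
    have h4 := Fintype.card_subtype_le fun e => 0 < w e
    have h5 : Fintype.card {l // l < k} = k := by
      rw [Fintype.card_subtype, Finset.filter_gt_eq_Iio, Fin.card_Iio]
    lia
  · intro α hα hne
    rw [LinearMap.mem_ker] at hα
    have hz : ∀ e, ¬ 0 < w e → α e = 0 := fun e he =>
      congrFun (congrArg Prod.fst hα) ⟨e, he⟩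
    have hl : ∀ l, l < k → G.fluxCoupling A φ k l α = 0 := fun l hlk =>
      congrFun (congrArg Prod.snd hα) ⟨l, hlk⟩
    obtain ⟨e₀, he₀⟩ := Function.ne_iff.1 hne
    have hpos : 0 < ∑ e, w e * (α e * α e) := by
      refine Finset.sum_pos' (fun e _ => ?_) ⟨e₀, Finset.mem_univ _, ?_⟩
      · by_cases he : 0 < w e
        · exact mul_nonneg he.le (mul_self_nonneg _)
        · simp [hz e he]
      · have hw : 0 < w e₀ := by
          by_contra h
          exact he₀ (hz e₀ h)
        exact mul_pos hw (mul_self_pos.2 he₀)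
    have hneg : ∑ l, G.fluxCoupling A φ k l α * G.fluxCoupling A φ k l α /
        (lam k - lam l) ≤ 0 := by
      refine Finset.sum_nonpos fun l _ => ?_
      rcases lt_or_ge l k with h | h
      · simp [hl l h]
      · exact div_nonpos_of_nonneg_of_nonpos (mul_self_nonneg _)
          (sub_nonpos.2 (hlam.monotone h))
    simp only [fluxHessian]
    linarith

theorem sum_nodalCount_sub_le_of_complete (hG : G.Connected) (hA : A.IsSymm)
    (hsupp : SupportedOn G A) (hlam : StrictMono lam)
    (heig : ∀ k, A.mulVec (φ k) = lam k • φ k)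
    (hcomplete : ∀ i j, ∑ k, φ k i * φ k j = if i = j then 1 else 0) :
    ∑ k : Fin n, ((nodalCount A (φ k) : ℤ) - ((k : ℕ) : ℤ)) ≤
      (n : ℤ) * (betti G : ℤ) - (betti G : ℤ) := by
  have := hG.nonempty
  choose N hN hneg using fun k => exists_fluxHessian_negative (φ := φ) hsupp hlam k
  have hzero : ∀ k α, ∀ γ ∈ LinearMap.range G.coboundary,
      G.fluxHessian A lam φ k α γ = 0 := by
    rintro k α _ ⟨x, rfl⟩
    exact fluxHessian_coboundary hA hsupp hlam.injective heig hcomplete k α x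
  have h := sum_finrank_negative_add_le (fun k α => G.fluxHessian A lam φ k α α)
    (LinearMap.range G.coboundary) N (fun k => by simp [fluxHessian])
    (fun k α γ hγ => by
      simp only [fluxHessian_add_self, hzero k _ γ hγ]
      ring)
    hneg (G.sum_fluxHessian_self A lam φ fun i j hij => by simp [hcomplete, hij])
  have hr := finrank_range_coboundary_add_one hG
  have hle := Submodule.finrank_le (LinearMap.range G.coboundary)
  rw [Module.finrank_fintype_fun_eq_card, card_orientedEdge] at h hle
  rw [Fintype.card_fin] at h
  have hb : (betti G : ℤ) =
      Nat.card G.edgeSet - Module.finrank ℝ (LinearMap.range G.coboundary) := by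
    rw [betti]
    lia
  have hs : ∑ k : Fin n, ((nodalCount A (φ k) : ℤ) - ((k : ℕ) : ℤ)) ≤
      ∑ k, (Module.finrank ℝ (N k) : ℤ) :=
    Finset.sum_le_sum fun k _ => by have := hN k; lia
  zify at h
  rw [hb]
  linarith

end SimpleGraph

theorem nodalCount_smul {n : ℕ} (A : Matrix (Fin n) (Fin n) ℝ) (φ : Fin n → ℝ) {c : ℝ}
    (hc : c ≠ 0) : nodalCount A (c • φ) = nodalCount A φ := by
  rw [nodalCount, nodalCount]
  have h : ∀ i j, A i j * (c • φ) i * (c • φ) j = (c * c) * (A i j * φ i * φ j) := by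
    intro i j
    simp only [Pi.smul_apply, smul_eq_mul]
    ring
  simp only [h, mul_pos_iff_of_pos_left (mul_self_pos.2 hc)]

/-- Eigenvectors of a real symmetric matrix for distinct eigenvalues are orthogonal. -/
theorem Matrix.IsSymm.dotProduct_eq_zero_of_mulVec_eq_smul {ι : Type*} [Fintype ι]
    {A : Matrix ι ι ℝ} (hA : A.IsSymm) {a b : ℝ} {x y : ι → ℝ} (hx : A.mulVec x = a • x)
    (hy : A.mulVec y = b • y) (hab : a ≠ b) : x ⬝ᵥ y = 0 := by
  have h : (A.mulVec x) ⬝ᵥ y = x ⬝ᵥ A.mulVec y := by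
    rw [dotProduct_mulVec, ← mulVec_transpose, hA.eq]
  rw [hx, hy, smul_dotProduct, dotProduct_smul, smul_eq_mul, smul_eq_mul] at h
  have h' : (a - b) * (x ⬝ᵥ y) = 0 := by linarith
  exact (mul_eq_zero.1 h').resolve_left (sub_ne_zero.2 hab)

/-- STATEMENT 0: for a connected graph `G` and a real symmetric matrix `A` satisfying the
Nodal Count Condition (strictly supported on `G`, simple eigenvalues `lam 0 < … < lam (n-1)`
with nowhere-vanishing eigenvectors `φ k`), the total nodal surplus is at most `n·β(G) - β(G)`. -/
theorem total_nodal_surplus_upper_bound {n : ℕ} (G : SimpleGraph (Fin n)) (hG : G.Connected)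
    (A : Matrix (Fin n) (Fin n) ℝ) (hA : A.IsSymm)
    (hsupp : SupportedOn G A) (hstrict : ∀ i j, G.Adj i j → A i j ≠ 0)
    (lam : Fin n → ℝ) (φ : Fin n → Fin n → ℝ) (hlam : StrictMono lam)
    (heig : ∀ k, A.mulVec (φ k) = lam k • φ k) (hnv : ∀ k i, φ k i ≠ 0) :
    ∑ k : Fin n, ((nodalCount A (φ k) : ℤ) - ((k : ℕ) : ℤ)) ≤ (n : ℤ) * (betti G : ℤ) - (betti G : ℤ) := by
  have := hG.nonempty
  have hpos : ∀ k, 0 < φ k ⬝ᵥ φ k := fun k =>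
    Finset.sum_pos (fun i _ => mul_self_pos.2 (hnv k i)) Finset.univ_nonempty
  let c : Fin n → ℝ := fun k => (√(φ k ⬝ᵥ φ k))⁻¹
  have hc : ∀ k, c k ≠ 0 := fun k => inv_ne_zero (Real.sqrt_pos.2 (hpos k)).ne'
  have hcc : ∀ k, c k * c k * (φ k ⬝ᵥ φ k) = 1 := by
    intro k
    rw [← mul_inv, Real.mul_self_sqrt (hpos k).le, inv_mul_cancel₀ (hpos k).ne']
  have hortho : Matrix.of (fun k => c k • φ k) * (Matrix.of fun k => c k • φ k)ᵀ = 1 := by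
    ext k l
    rw [Matrix.mul_apply', Matrix.one_apply]
    change (c k • φ k) ⬝ᵥ (c l • φ l) = _
    rw [smul_dotProduct, dotProduct_smul, smul_eq_mul, smul_eq_mul, ← mul_assoc]
    split_ifs with h
    · rw [← h, hcc]
    · rw [hA.dotProduct_eq_zero_of_mulVec_eq_smul (heig k) (heig l) (hlam.injective.ne h),
        mul_zero]
  have hcomplete := mul_eq_one_comm.1 hortho
  have h := SimpleGraph.sum_nodalCount_sub_le_of_complete (φ := fun k => c k • φ k)
    hG hA hsupp hlam
    (fun k => by rw [Matrix.mulVec_smul, heig, smul_comm])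
    (fun i j => by
      have h := congrFun (congrFun hcomplete i) j
      rwa [Matrix.mul_apply, Matrix.one_apply] at h)
  simpa only [nodalCount_smul A _ (hc _)] using h
end

section
/- Let G_1 be a connected simple graph on n_1 vertices in which vertex n_1 is adjacent to all other vertices of G_1, let G_2 be a connected simple graph on n_2 vertices, and let G be the graph on n = n_1 + n_2 vertices obtained from the disjoint union of G_1 and G_2 by adding one edge between vertex n_1 of G_1 and vertex 1 of G_2. Let A_1 ∈ S(G_1) and A_2 ∈ S(G_2) satisfy the Nodal Count Condition, have only non-positive entries, and have total nodal counts ν_1 and ν_2 respectively. Then there exists s > 0 such that for all sufficiently small ε > 0, the block matrix A_ε with blocks [A_1 − sI, −ε e_{n_1} e_1^T; −ε e_1 e_{n_1}^T, A_2] belongs to S(G), satisfies the Nodal Count Condition, and has total nodal count ν_1 + ν_2 + n_1·n_2. -/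
open Matrix

/-- The nodal count for a matrix indexed by an arbitrary vertex type (each unordered pair
is counted once, by symmetry of the sign condition). -/
noncomputable def nodalCountSym {V : Type*} (A : Matrix V V ℝ) (φ : V → ℝ) : ℕ :=
  Nat.card {p : V × V // p.1 ≠ p.2 ∧ 0 < A p.1 p.2 * φ p.1 * φ p.2} / 2

/-- The graph obtained from the disjoint union of `G1` and `G2` by adding a single edge
between vertex `v` of `G1` and vertex `w` of `G2`. -/
def joinGraph {n1 n2 : ℕ} (G1 : SimpleGraph (Fin n1)) (G2 : SimpleGraph (Fin n2))
    (v : Fin n1) (w : Fin n2) : SimpleGraph (Fin n1 ⊕ Fin n2) :=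
  SimpleGraph.fromRel (fun x y =>
    match x, y with
    | Sum.inl a, Sum.inl b => G1.Adj a b
    | Sum.inr a, Sum.inr b => G2.Adj a b
    | Sum.inl a, Sum.inr b => a = v ∧ b = w
    | Sum.inr _, Sum.inl _ => False)

/-- The block matrix `[A1 - s I, -ε e_v e_wᵀ; -ε e_w e_vᵀ, A2]`. -/
noncomputable def joinMatrix {n1 n2 : ℕ} (A1 : Matrix (Fin n1) (Fin n1) ℝ)
    (A2 : Matrix (Fin n2) (Fin n2) ℝ) (v : Fin n1) (w : Fin n2) (s ε : ℝ) :
    Matrix (Fin n1 ⊕ Fin n2) (Fin n1 ⊕ Fin n2) ℝ :=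
  Matrix.of fun x y =>
    match x, y with
    | Sum.inl i, Sum.inl j => A1 i j - (if i = j then s else 0)
    | Sum.inr i, Sum.inr j => A2 i j
    | Sum.inl i, Sum.inr j => if i = v ∧ j = w then -ε else 0
    | Sum.inr i, Sum.inl j => if i = w ∧ j = v then -ε else 0

section

open Filter Topology

lemma exists_sum_smul_eigenvectors_eq {ι : Type*} [Fintype ι] [DecidableEq ι]
    {A : Matrix ι ι ℝ} {lam : ι → ℝ} {φ : ι → ι → ℝ} (hlam : Function.Injective lam)
    (heig : ∀ k, A *ᵥ φ k = lam k • φ k) (hφ : ∀ k, φ k ≠ 0) (u : ι → ℝ) :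
    ∃ c : ι → ℝ, ∑ j, c j • φ j = u := by
  have hli : LinearIndependent ℝ φ := by
    refine Module.End.eigenvectors_linearIndependent' (Matrix.toLin' A) lam hlam φ fun k => ?_
    rw [Module.End.hasEigenvector_iff, Module.End.mem_eigenspace_iff]
    exact ⟨by simpa using heig k, hφ k⟩
  have hspan := hli.span_eq_top_of_card_eq_finrank' (by simp)
  have hu : u ∈ Submodule.span ℝ (Set.range φ) := by rw [hspan]; trivial
  exact Submodule.mem_span_range_iff_exists_fun ℝ |>.1 hu

/-- If `∑ j, c j • φ j = u` and `φ j` is an eigenvector for `lam j`, this is `(A - μ)⁻¹ u`. -/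
noncomputable def resolventVec {ι : Type*} [Fintype ι] (lam : ι → ℝ) (φ : ι → ι → ℝ)
    (c : ι → ℝ) (μ : ℝ) : ι → ℝ :=
  ∑ j, (c j / (lam j - μ)) • φ j

lemma mulVec_resolventVec {ι : Type*} [Fintype ι] {A : Matrix ι ι ℝ} {lam : ι → ℝ}
    {φ : ι → ι → ℝ} {c : ι → ℝ} {u : ι → ℝ} (heig : ∀ k, A *ᵥ φ k = lam k • φ k)
    (hc : ∑ j, c j • φ j = u) {μ : ℝ} (hμ : ∀ j, lam j ≠ μ) :
    A *ᵥ resolventVec lam φ c μ = μ • resolventVec lam φ c μ + u := by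
  simp only [resolventVec, Matrix.mulVec_sum, Matrix.mulVec_smul, heig, ← hc, Finset.smul_sum,
    ← Finset.sum_add_distrib, smul_smul, ← add_smul]
  refine Finset.sum_congr rfl fun j _ => ?_
  have := sub_ne_zero.2 (hμ j)
  congr 1
  field_simp
  ring

lemma continuousAt_resolventVec {ι : Type*} [Fintype ι] {lam : ι → ℝ} (φ : ι → ι → ℝ)
    (c : ι → ℝ) {μ : ℝ} (hμ : ∀ j, lam j ≠ μ) : ContinuousAt (resolventVec lam φ c) μ := by
  unfold resolventVec
  refine tendsto_finsetSum _ fun j _ => ?_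
  refine ContinuousAt.smul (f := fun μ => c j / (lam j - μ)) ?_ continuousAt_const
  exact continuousAt_const.div (by fun_prop) (sub_ne_zero.2 (hμ j))

lemma eventually_forall_ne {ι : Type*} [Finite ι] (lam : ι → ℝ) {μ : ℝ} (hμ : ∀ j, lam j ≠ μ) :
    ∀ᶠ z in 𝓝 μ, ∀ j, lam j ≠ z :=
  eventually_all.2 fun j => (isOpen_ne.eventually_mem (hμ j).symm).mono fun _ h => Ne.symm h

/-- Persistence of an eigenvector `φ i` of `B` when `B` is weakly coupled to a block `C` whose
spectrum does not contain the eigenvalue; `R` is the vector `(C - μ)⁻¹ e_w`. -/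
lemma exists_coupled_eigenvector {ι κ : Type*} [Fintype ι] [DecidableEq ι] [Fintype κ]
    [DecidableEq κ] {B : Matrix ι ι ℝ} {C : Matrix κ κ ℝ} {v : ι} {w : κ} {lam : ι → ℝ}
    {φ : ι → ι → ℝ} (hlam : Function.Injective lam) (heig : ∀ k, B *ᵥ φ k = lam k • φ k)
    {c : ι → ℝ} (hc : ∑ j, c j • φ j = Pi.single v 1) {i : ι} (hiv : φ i v ≠ 0)
    {R : ℝ → κ → ℝ}
    (hR : ∀ᶠ μ in 𝓝 (lam i), ContinuousAt R μ ∧ C *ᵥ R μ = μ • R μ + Pi.single w 1)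
    {δ : ℝ} (hδ : 0 < δ) {U : Set (ι → ℝ)} (hU : U ∈ 𝓝 ((φ i v)⁻¹ • φ i))
    {V : Set (κ → ℝ)} (hV : V ∈ 𝓝 (R (lam i))) :
    ∀ᶠ ε in 𝓝[>] (0 : ℝ), ∃ μ x y, |μ - lam i| < δ ∧ x ∈ U ∧ y ∈ V ∧ x v = 1 ∧
      B *ᵥ x = μ • x + (ε * ε * y w) • Pi.single v 1 ∧ C *ᵥ y = μ • y + Pi.single w 1 := by
  set S : ℝ → ι → ℝ := fun μ => ∑ j ∈ Finset.univ.erase i, (c j / (lam j - μ)) • φ j with hS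
  set x : ℝ → ℝ → ι → ℝ := fun ε μ =>
    ((1 - ε * ε * R μ w * S μ v) / φ i v) • φ i + (ε * ε * R μ w) • S μ with hx
  have hne : ∀ᶠ μ in 𝓝 (lam i), ∀ j, j ≠ i → lam j ≠ μ := by
    refine eventually_all.2 fun j => ?_
    by_cases hj : j = i
    · simp [hj]
    · filter_upwards [isOpen_ne.mem_nhds (hlam.ne hj).symm] with z hz _ using Ne.symm hz
  have hScont : ∀ {μ : ℝ}, (∀ j, j ≠ i → lam j ≠ μ) → ContinuousAt S μ := by
    intro μ hμ
    refine tendsto_finsetSum _ fun j hj => ?_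
    refine ContinuousAt.smul (f := fun μ => c j / (lam j - μ)) ?_ continuousAt_const
    exact continuousAt_const.div (by fun_prop) (sub_ne_zero.2 (hμ j (Finset.ne_of_mem_erase hj)))
  have hRi : ContinuousAt R (lam i) := hR.self_of_nhds.1
  have hSi : ContinuousAt S (lam i) := hScont hne.self_of_nhds
  have hxi : ContinuousAt (fun p : ℝ × ℝ => x p.1 p.2) (0, lam i) := by
    have h1 : ContinuousAt (fun p : ℝ × ℝ => R p.2) (0, lam i) :=
      ContinuousAt.comp (g := R) (f := Prod.snd) hRi continuousAt_snd
    have h2 : ContinuousAt (fun p : ℝ × ℝ => S p.2) (0, lam i) :=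
      ContinuousAt.comp (g := S) (f := Prod.snd) hSi continuousAt_snd
    have h3 := continuousAt_pi.1 h1 w
    have h4 := continuousAt_pi.1 h2 v
    have h5 : ContinuousAt (fun p : ℝ × ℝ => p.1 * p.1 * R p.2 w) (0, lam i) :=
      (continuousAt_fst.mul continuousAt_fst).mul h3
    exact (((continuousAt_const.sub (h5.mul h4)).div_const _).smul continuousAt_const).add
      (h5.smul h2)
  have hx0 : x 0 (lam i) = (φ i v)⁻¹ • φ i := by simp [hx]
  have hxU : ∀ᶠ p : ℝ × ℝ in 𝓝 (0, lam i), x p.1 p.2 ∈ U :=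
    hxi (by simpa only [hx0] using hU)
  rw [nhds_prod_eq] at hxU
  obtain ⟨P, hP, Q, hQ, hPQ⟩ := eventually_prod_iff.1 hxU
  obtain ⟨r, hr, hball⟩ := Metric.eventually_nhds_iff_ball.1
    (hQ.and (hR.and (hne.and (hRi.eventually_mem hV))))
  obtain ⟨r', hr', hr'r, hr'δ⟩ : ∃ r', 0 < r' ∧ r' < r ∧ r' < δ :=
    ⟨min r δ / 2, by positivity, by linarith [min_le_left r δ, lt_min hr hδ],
      by linarith [min_le_right r δ, lt_min hr hδ]⟩
  set H : ℝ → ℝ → ℝ := fun ε μ =>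
    (1 - ε * ε * R μ w * S μ v) * (lam i - μ) - ε * ε * R μ w * c i * φ i v with hH
  have hHε : ∀ μ, Tendsto (fun ε => H ε μ) (𝓝[>] 0) (𝓝 (lam i - μ)) := by
    intro μ
    have : Continuous (fun ε => H ε μ) := by simp only [hH]; fun_prop
    have h := this.tendsto 0
    simp only [hH, mul_zero, zero_mul, sub_zero, one_mul] at h
    exact h.mono_left nhdsWithin_le_nhds
  have hlow := (hHε (lam i - r')).eventually_const_lt (u := 0) (by linarith)
  have hhigh := (hHε (lam i + r')).eventually_lt_const (u := 0) (by linarith)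
  filter_upwards [hlow, hhigh, hP.filter_mono nhdsWithin_le_nhds] with ε h1 h2 hPε
  have hmem : ∀ μ ∈ Set.Icc (lam i - r') (lam i + r'), μ ∈ Metric.ball (lam i) r := by
    intro μ hμ
    rw [Metric.mem_ball, Real.dist_eq, abs_lt]
    constructor <;> linarith [hμ.1, hμ.2]
  have hcont : ContinuousOn (H ε) (Set.Icc (lam i - r') (lam i + r')) := by
    intro μ hμ
    obtain ⟨-, ⟨hRc, -⟩, hn, -⟩ := hball μ (hmem μ hμ)
    have h3 := continuousAt_pi.1 hRc w
    have h4 := continuousAt_pi.1 (hScont hn) v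
    refine ContinuousAt.continuousWithinAt ?_
    simp only [hH]
    fun_prop
  obtain ⟨μ, hμ, hμ0⟩ := intermediate_value_Icc' (by linarith) hcont ⟨h2.le, h1.le⟩
  obtain ⟨hQμ, ⟨-, hReq⟩, hn, hRV⟩ := hball μ (hmem μ hμ)
  refine ⟨μ, x ε μ, R μ, ?_, hPQ hPε hQμ, hRV, ?_, ?_, hReq⟩
  · rw [abs_lt]
    constructor <;> linarith [hμ.1, hμ.2]
  · simp only [hx, Pi.add_apply, Pi.smul_apply, smul_eq_mul]
    field_simp
    ring
  · have hBS : B *ᵥ S μ = μ • S μ + (Pi.single v 1 - c i • φ i) := by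
      rw [← hc, ← Finset.add_sum_erase _ _ (Finset.mem_univ i), add_sub_cancel_left]
      simp only [hS, Matrix.mulVec_sum, Matrix.mulVec_smul, heig, Finset.smul_sum,
        ← Finset.sum_add_distrib, smul_smul, ← add_smul]
      refine Finset.sum_congr rfl fun j hj => ?_
      have := sub_ne_zero.2 (hn j (Finset.ne_of_mem_erase hj))
      congr 1
      field_simp
      ring
    have hcoef : (1 - ε * ε * R μ w * S μ v) / φ i v * lam i =
        (1 - ε * ε * R μ w * S μ v) / φ i v * μ + ε * ε * R μ w * c i := by
      simp only [hH] at hμ0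
      field_simp
      linear_combination hμ0
    simp only [hx, Matrix.mulVec_add, Matrix.mulVec_smul, hBS, heig]
    ext a
    simp only [Pi.add_apply, Pi.smul_apply, Pi.sub_apply, smul_eq_mul]
    linear_combination φ i a * hcoef

lemma resolventVec_eventually_atTop {ι : Type*} [Fintype ι] [DecidableEq ι]
    {A : Matrix ι ι ℝ} {lam : ι → ℝ} {φ : ι → ι → ℝ} {c : ι → ℝ} {v : ι}
    (heig : ∀ k, A *ᵥ φ k = lam k • φ k) (hc : ∑ j, c j • φ j = Pi.single v 1)
    (hneg : ∀ a, a ≠ v → A a v < 0) :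
    ∀ᶠ t in atTop, ∀ a, 0 < resolventVec lam φ c t a * (if a = v then -1 else 1) := by
  have hinv : ∀ l : ℝ, Tendsto (fun t : ℝ => (l - t)⁻¹) atTop (𝓝 0) := fun l =>
    (tendsto_atBot_add_const_left _ l tendsto_neg_atTop_atBot).inv_tendsto_atBot
  refine eventually_all.2 fun a => ?_
  have h0 : ∑ j, c j * φ j a = Pi.single (M := fun _ => ℝ) v 1 a := by
    simpa using congrFun hc a
  have h1 : ∑ j, c j * lam j * φ j a = A a v := by
    have := congrFun (congrArg (A *ᵥ ·) hc) a
    simp only [Matrix.mulVec_sum, Matrix.mulVec_smul, heig, Finset.sum_apply, Pi.smul_apply,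
      smul_eq_mul, Matrix.mulVec_single_one, Matrix.col_apply] at this
    rw [← this]
    exact Finset.sum_congr rfl fun j _ => by ring
  have hne : ∀ᶠ t in atTop, ∀ j, lam j - t ≠ 0 := by
    refine eventually_all.2 fun j => ?_
    filter_upwards [eventually_gt_atTop (lam j)] with t ht using (sub_neg.2 ht).ne
  have key : ∀ (f : ι → ℝ), Tendsto (fun t => ∑ j, f j * (lam j - t)⁻¹) atTop (𝓝 0) := by
    intro f
    simpa using tendsto_finsetSum Finset.univ fun j _ => (hinv (lam j)).const_mul (f j)
  by_cases ha : a = v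
  · subst ha
    have hlim : Tendsto (fun t => t * resolventVec lam φ c t a) atTop (𝓝 (-1)) := by
      have := (key fun j => c j * lam j * φ j a).const_add (-1)
      rw [add_zero] at this
      refine this.congr' ?_
      filter_upwards [hne] with t ht
      rw [Pi.single_eq_same] at h0
      rw [← h0]
      simp only [resolventVec, Finset.sum_apply, Pi.smul_apply, smul_eq_mul, Finset.mul_sum,
        ← Finset.sum_neg_distrib, ← Finset.sum_add_distrib]
      refine Finset.sum_congr rfl fun j _ => ?_
      have := ht j
      field_simp
      ring
    filter_upwards [hlim.eventually_lt_const (u := 0) (by norm_num), eventually_gt_atTop 0]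
      with t h2 h3
    simp only [if_true]
    linarith [neg_of_mul_neg_right h2 h3.le]
  · have hlim : Tendsto (fun t => t * t * resolventVec lam φ c t a) atTop (𝓝 (-A a v)) := by
      have := (key fun j => c j * lam j * lam j * φ j a).const_add (-A a v)
      rw [add_zero] at this
      refine this.congr' ?_
      filter_upwards [hne] with t ht
      rw [Pi.single_eq_of_ne ha] at h0
      have : -A a v = -(∑ j, c j * lam j * φ j a) - t * ∑ j, c j * φ j a := by rw [h0, h1]; ring
      rw [this]
      simp only [resolventVec, Finset.sum_apply, Pi.smul_apply, smul_eq_mul, Finset.mul_sum,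
        ← Finset.sum_neg_distrib, ← Finset.sum_add_distrib, ← Finset.sum_sub_distrib]
      refine Finset.sum_congr rfl fun j _ => ?_
      have := ht j
      field_simp
      ring
    filter_upwards [hlim.eventually_const_lt (u := 0) (by linarith [hneg a ha])] with t h2
    simp only [if_neg ha, mul_one]
    exact pos_of_mul_pos_right h2 (mul_self_nonneg t)

/-- The resolvent of a matrix with non-positive entries, supported on a connected graph, is
entrywise positive far below the spectrum. -/
lemma pos_of_mulVec_eq_smul_add_single {V : Type*} [Fintype V] [DecidableEq V]
    {G : SimpleGraph V} (hG : G.Connected) {A : Matrix V V ℝ} (hneg : ∀ i j, A i j ≤ 0)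
    (hstr : ∀ i j, G.Adj i j → A i j ≠ 0) {w : V} {t : ℝ} (ht : ∀ i, t < ∑ j, A i j)
    {z : V → ℝ} (hz : A *ᵥ z = t • z + Pi.single w 1) (i : V) : 0 < z i := by
  have hrow : ∀ m, ∑ j, A m j * z j = t * z m + Pi.single (M := fun _ => ℝ) w 1 m := fun m => by
    simpa [Matrix.mulVec, dotProduct] using congrFun hz m
  have hs : ∀ m, 0 ≤ Pi.single (M := fun _ => ℝ) w 1 m := fun m => by
    by_cases h : m = w
    · subst h; simp
    · simp [h]
  have : Nonempty V := ⟨w⟩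
  obtain ⟨m, hm⟩ := Finite.exists_min z
  have hz0 : ∀ j, 0 ≤ z j := by
    refine fun j => le_trans ?_ (hm j)
    have h1 : ∑ j, A m j * z j ≤ (∑ j, A m j) * z m := by
      rw [Finset.sum_mul]
      exact Finset.sum_le_sum fun j _ => mul_le_mul_of_nonpos_left (hm j) (hneg m j)
    by_contra! h
    nlinarith [hrow m, hs m, ht m]
  have hterm : ∀ a b, z a = 0 → A a b * z b = 0 ∧ a ≠ w := by
    intro a b ha
    have h1 := hrow a
    rw [ha, mul_zero, zero_add] at h1
    have hnp : ∀ j ∈ Finset.univ, A a j * z j ≤ 0 := fun j _ =>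
      mul_nonpos_of_nonpos_of_nonneg (hneg a j) (hz0 j)
    have h2 := le_antisymm (Finset.sum_nonpos hnp) (h1 ▸ hs a)
    refine ⟨(Finset.sum_eq_zero_iff_of_nonpos hnp).1 h2 b (Finset.mem_univ b), ?_⟩
    rintro rfl
    simp [h2] at h1
  have hwalk : ∀ a b, G.Walk a b → z a = 0 → z b = 0 := by
    intro a b p
    induction p with
    | nil => exact id
    | cons h _ ih =>
      exact fun ha => ih ((mul_eq_zero.1 (hterm _ _ ha).1).resolve_left (hstr _ _ h))
  refine lt_of_le_of_ne (hz0 i) fun h => ?_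
  obtain ⟨p⟩ := hG.preconnected i w
  exact (hterm w w (hwalk _ _ p h.symm)).2 rfl

lemma card_offDiag_eq_two_mul_nodalCount {n : ℕ} {A : Matrix (Fin n) (Fin n) ℝ} (hA : A.IsSymm)
    (φ : Fin n → ℝ) :
    Nat.card {p : Fin n × Fin n // p.1 ≠ p.2 ∧ 0 < A p.1 p.2 * φ p.1 * φ p.2} =
      2 * nodalCount A φ := by
  classical
  have hsymm : ∀ i j, 0 < A i j * φ i * φ j ↔ 0 < A j i * φ j * φ i := fun i j => by
    rw [hA.apply, mul_right_comm]
  simp only [nodalCount, Nat.card_eq_fintype_card, Fintype.card_subtype]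
  set s := Finset.univ.filter fun p : Fin n × Fin n => p.1 < p.2 ∧ 0 < A p.1 p.2 * φ p.1 * φ p.2
  have : (Finset.univ.filter fun p : Fin n × Fin n =>
      p.1 ≠ p.2 ∧ 0 < A p.1 p.2 * φ p.1 * φ p.2) = s ∪ s.image Prod.swap := by
    ext ⟨i, j⟩
    simp only [s, Finset.mem_filter, Finset.mem_univ, true_and, Finset.mem_union,
      Finset.mem_image, Prod.exists, Prod.swap_prod_mk, Prod.mk.injEq]
    constructor
    · rintro ⟨hne, h⟩
      rcases lt_or_gt_of_ne hne with hlt | hlt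
      · exact Or.inl ⟨hlt, h⟩
      · exact Or.inr ⟨j, i, ⟨hlt, (hsymm i j).1 h⟩, rfl, rfl⟩
    · rintro (⟨hlt, h⟩ | ⟨a, b, ⟨hlt, h⟩, rfl, rfl⟩)
      · exact ⟨hlt.ne, h⟩
      · exact ⟨hlt.ne', (hsymm _ _).1 h⟩
  rw [this, Finset.card_union_of_disjoint, Finset.card_image_of_injective _ Prod.swap_injective,
    two_mul]
  rw [Finset.disjoint_left]
  rintro ⟨i, j⟩ h1 h2
  simp only [s, Finset.mem_filter, Finset.mem_univ, true_and, Finset.mem_image, Prod.exists,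
    Prod.swap_prod_mk, Prod.mk.injEq] at h1 h2
  obtain ⟨a, b, ⟨h, -⟩, rfl, rfl⟩ := h2
  exact lt_asymm h h1.1

lemma nodalCountSym_joinMatrix {n1 n2 : ℕ} {A1 : Matrix (Fin n1) (Fin n1) ℝ}
    {A2 : Matrix (Fin n2) (Fin n2) ℝ} (hA1 : A1.IsSymm) (hA2 : A2.IsSymm) (v : Fin n1)
    (w : Fin n2) (s : ℝ) {ε : ℝ} (hε : 0 < ε) (x : Fin n1 → ℝ) (y : Fin n2 → ℝ) :
    nodalCountSym (joinMatrix A1 A2 v w s ε) (Sum.elim x y) =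
      nodalCount A1 x + nodalCount A2 y + if x v * y w < 0 then 1 else 0 := by
  classical
  have h1 := card_offDiag_eq_two_mul_nodalCount hA1 x
  have h2 := card_offDiag_eq_two_mul_nodalCount hA2 y
  have hcross : ∀ a b : ℝ, 0 < ε * (a * b) * (-1) ↔ a * b < 0 := fun a b => by
    constructor
    · intro h; by_contra! h'; nlinarith [mul_nonneg hε.le h']
    · intro h; nlinarith [mul_neg_of_pos_of_neg hε h]
  have hlr : ∀ i j, (0 < (if i = v ∧ j = w then -ε else 0) * x i * y j) ↔
      (i = v ∧ j = w) ∧ x v * y w < 0 := fun i j => by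
    split_ifs with h
    · obtain ⟨rfl, rfl⟩ := h
      rw [← hcross]
      simp [mul_assoc]
    · simp [h]
  have hrl : ∀ j i, (0 < (if j = w ∧ i = v then -ε else 0) * y j * x i) ↔
      (j = w ∧ i = v) ∧ x v * y w < 0 := fun j i => by
    split_ifs with h
    · obtain ⟨rfl, rfl⟩ := h
      rw [← hcross]
      simp [mul_left_comm, mul_comm]
    · simp [h]
  have hll : ∀ i j, (i ≠ j ∧ 0 < (A1 i j - if i = j then s else 0) * x i * x j) ↔
      (i ≠ j ∧ 0 < A1 i j * x i * x j) := fun i j =>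
    and_congr_right fun h => by simp [h]
  simp only [Nat.card_eq_fintype_card, Fintype.card_subtype, Finset.card_filter,
    Fintype.sum_prod_type] at h1 h2
  simp only [nodalCountSym, Nat.card_eq_fintype_card, Fintype.card_subtype, Finset.card_filter,
    Fintype.sum_prod_type, Fintype.sum_sum_type, joinMatrix, Matrix.of_apply, Sum.elim_inl,
    Sum.elim_inr, ne_eq, Sum.inl.injEq, Sum.inr.injEq, reduceCtorEq, not_false_eq_true, true_and,
    hlr, hrl, Finset.sum_add_distrib]
  simp only [ne_eq] at hll h1 h2
  simp only [hll, h1, h2]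
  simp only [ite_and, Finset.sum_ite_eq', Finset.sum_ite_irrel, Finset.sum_const_zero,
    Finset.mem_univ, if_true]
  split_ifs <;> omega

lemma nodalCount_congr_sign {n : ℕ} {A : Matrix (Fin n) (Fin n) ℝ} {x φ : Fin n → ℝ} {c : ℝ}
    (h : ∀ i, 0 < x i * (c * φ i)) : nodalCount A x = nodalCount A φ := by
  have key : ∀ i j, 0 < A i j * x i * x j ↔ 0 < A i j * φ i * φ j := fun i j => by
    have hc : 0 < c * c := mul_self_pos.2 fun hc => by simpa [hc] using h i
    have hp := mul_pos (h i) (h j)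
    have hxx : 0 < (x i * x j) * (φ i * φ j) := by
      refine pos_of_mul_pos_right (a := c * c) ?_ hc.le
      linarith
    rcases mul_pos_iff.1 hxx with ⟨h1, h2⟩ | ⟨h1, h2⟩
    · rw [mul_assoc, mul_assoc, mul_pos_iff_of_pos_right h1, mul_pos_iff_of_pos_right h2]
    · rw [mul_assoc, mul_assoc, ← neg_mul_neg, mul_pos_iff_of_pos_right (neg_pos.2 h1),
        ← neg_mul_neg (A i j) (φ i * φ j), mul_pos_iff_of_pos_right (neg_pos.2 h2)]
  simp only [nodalCount, key]

lemma nodalCount_eq_zero_of_pos {n : ℕ} {A : Matrix (Fin n) (Fin n) ℝ} (hA : ∀ i j, A i j ≤ 0)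
    {x : Fin n → ℝ} (hx : ∀ i, 0 < x i) : nodalCount A x = 0 := by
  rw [nodalCount, Nat.card_eq_zero]
  refine Or.inl ⟨fun ⟨⟨i, j⟩, _, h⟩ => absurd h (not_lt.2 ?_)⟩
  rw [mul_assoc]
  exact mul_nonpos_of_nonpos_of_nonneg (hA i j) (mul_pos (hx i) (hx j)).le

/-- A vector whose only negative entry is at a dominating vertex changes sign exactly across
the edges at that vertex. -/
lemma nodalCount_add_one_of_neg_only_at {n : ℕ} {A : Matrix (Fin n) (Fin n) ℝ} (hA : A.IsSymm)
    (hneg : ∀ i j, A i j ≤ 0) {v : Fin n} (hv : ∀ a, a ≠ v → A a v < 0) {x : Fin n → ℝ}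
    (hx : ∀ a, 0 < x a * (if a = v then -1 else 1)) : nodalCount A x + 1 = n := by
  classical
  have hxv : x v < 0 := by simpa using hx v
  have hxa : ∀ a, a ≠ v → 0 < x a := fun a ha => by simpa [ha] using hx a
  have key : ∀ i j, (i ≠ j ∧ 0 < A i j * x i * x j) ↔ (i = v ∧ j ≠ v) ∨ (i ≠ v ∧ j = v) := by
    intro i j
    by_cases hi : i = v <;> by_cases hj : j = v
    · simp [hi, hj]
    · subst hi
      have h1 : 0 < A i j * x i := by
        rw [← hA.apply]
        exact mul_pos_of_neg_of_neg (hv j hj) hxv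
      simp [hj, Ne.symm hj, mul_pos h1 (hxa j hj)]
    · subst hj
      simp [hi, mul_pos_of_neg_of_neg (mul_neg_of_neg_of_pos (hv i hi) (hxa i hi)) hxv]
    · simp only [hi, hj, false_and, and_false, or_self, iff_false, not_and, not_lt]
      intro _
      rw [mul_assoc]
      exact mul_nonpos_of_nonpos_of_nonneg (hneg i j) (mul_pos (hxa i hi) (hxa j hj)).le
  have h := card_offDiag_eq_two_mul_nodalCount hA x
  simp only [key, Nat.card_eq_fintype_card, Fintype.card_subtype] at h
  have hset : (Finset.univ.filter fun p : Fin n × Fin n =>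
      (p.1 = v ∧ p.2 ≠ v) ∨ (p.1 ≠ v ∧ p.2 = v)) =
      ({v} ×ˢ Finset.univ.erase v) ∪ (Finset.univ.erase v ×ˢ {v}) := by
    ext ⟨i, j⟩
    simp only [Finset.mem_filter, Finset.mem_univ, true_and, Finset.mem_union,
      Finset.mem_product, Finset.mem_singleton, Finset.mem_erase, and_true]
  rw [hset, Finset.card_union_of_disjoint, Finset.card_product, Finset.card_product,
    Finset.card_erase_of_mem (Finset.mem_univ v)] at h
  · have := v.pos
    simp at h
    omega
  · rw [Finset.disjoint_left]
    rintro ⟨i, j⟩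
    simp only [Finset.mem_product, Finset.mem_singleton, Finset.mem_erase]
    rintro ⟨rfl, -⟩ ⟨⟨h, -⟩, -⟩
    exact h rfl

lemma joinMatrix_isSymm {n1 n2 : ℕ} {A1 : Matrix (Fin n1) (Fin n1) ℝ}
    {A2 : Matrix (Fin n2) (Fin n2) ℝ} (hA1 : A1.IsSymm) (hA2 : A2.IsSymm) (v : Fin n1)
    (w : Fin n2) (s ε : ℝ) : (joinMatrix A1 A2 v w s ε).IsSymm := by
  refine Matrix.IsSymm.ext fun i j => ?_
  rcases i with i | i <;> rcases j with j | j <;>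
    simp [joinMatrix, fun a b => hA1.apply a b, fun a b => hA2.apply a b, eq_comm, and_comm]

lemma joinMatrix_supportedOn {n1 n2 : ℕ} {G1 : SimpleGraph (Fin n1)} {G2 : SimpleGraph (Fin n2)}
    {A1 : Matrix (Fin n1) (Fin n1) ℝ} {A2 : Matrix (Fin n2) (Fin n2) ℝ}
    (h1 : SupportedOn G1 A1) (h2 : SupportedOn G2 A2) (v : Fin n1) (w : Fin n2) (s ε : ℝ) :
    SupportedOn (joinGraph G1 G2 v w) (joinMatrix A1 A2 v w s ε) := by
  rintro (i | i) (j | j) hne hadj <;>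
    simp only [joinGraph, SimpleGraph.fromRel_adj, hne, ne_eq, not_false_eq_true, true_and,
      not_or, or_false, false_or] at hadj
  · have : i ≠ j := fun h => hne (h ▸ rfl)
    simp [joinMatrix, h1 i j this hadj.1, this]
  · simp [joinMatrix, hadj]
  · simp only [joinMatrix, Matrix.of_apply, ite_eq_right_iff]
    exact fun h => absurd h.symm hadj
  · have : i ≠ j := fun h => hne (h ▸ rfl)
    simp [joinMatrix, h2 i j this hadj.1]

lemma joinMatrix_ne_zero_of_adj {n1 n2 : ℕ} {G1 : SimpleGraph (Fin n1)}
    {G2 : SimpleGraph (Fin n2)} {A1 : Matrix (Fin n1) (Fin n1) ℝ}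
    {A2 : Matrix (Fin n2) (Fin n2) ℝ} (h1 : ∀ i j, G1.Adj i j → A1 i j ≠ 0)
    (h2 : ∀ i j, G2.Adj i j → A2 i j ≠ 0) (v : Fin n1) (w : Fin n2) (s : ℝ) {ε : ℝ}
    (hε : ε ≠ 0) (x y : Fin n1 ⊕ Fin n2) (hxy : (joinGraph G1 G2 v w).Adj x y) :
    joinMatrix A1 A2 v w s ε x y ≠ 0 := by
  rcases x with i | i <;> rcases y with j | j <;>
    simp only [joinGraph, SimpleGraph.fromRel_adj, ne_eq, or_false, false_or] at hxy
  · have h := hxy.2.elim id SimpleGraph.Adj.symm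
    simpa [joinMatrix, h.ne] using h1 i j h
  · simp [joinMatrix, hxy.2, hε]
  · simp [joinMatrix, hxy.2, hε]
  · simpa [joinMatrix] using h2 i j (hxy.2.elim id SimpleGraph.Adj.symm)

lemma joinMatrix_mulVec_elim {n1 n2 : ℕ} (A1 : Matrix (Fin n1) (Fin n1) ℝ)
    (A2 : Matrix (Fin n2) (Fin n2) ℝ) (v : Fin n1) (w : Fin n2) (s ε : ℝ) (x : Fin n1 → ℝ)
    (y : Fin n2 → ℝ) :
    joinMatrix A1 A2 v w s ε *ᵥ Sum.elim x y =
      Sum.elim (A1 *ᵥ x - s • x - (ε * y w) • Pi.single v 1)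
        (A2 *ᵥ y - (ε * x v) • Pi.single w 1) := by
  ext (i | i)
  · simp [joinMatrix, Matrix.mulVec, dotProduct, sub_mul, ite_and, Pi.single_apply]
    split_ifs <;> ring
  · simp [joinMatrix, Matrix.mulVec, dotProduct, ite_and, Pi.single_apply]
    split_ifs <;> ring

lemma exists_pos_separation {ι : Type*} [Finite ι] {e : ι → ℝ} (he : Function.Injective e) :
    ∃ δ > 0, ∀ a b, a ≠ b → 2 * δ < |e a - e b| := by
  have h : ∀ᶠ δ in 𝓝[>] (0 : ℝ), ∀ a b, a ≠ b → 2 * δ < |e a - e b| := by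
    refine eventually_all.2 fun a => eventually_all.2 fun b => ?_
    by_cases hab : a = b
    · simp [hab]
    have hpos : 0 < |e a - e b| / 2 := half_pos (abs_pos.2 (sub_ne_zero.2 (he.ne hab)))
    filter_upwards [Ioo_mem_nhdsGT hpos] with δ hδ _
    linarith [hδ.2]
  obtain ⟨δ, h1, h2⟩ := (h.and self_mem_nhdsWithin).exists
  exact ⟨δ, h2, h1⟩

/-- A positivity pattern of a vector persists nearby. -/
lemma setOf_forall_mul_pos_mem_nhds {ι : Type*} [Finite ι] {σ z : ι → ℝ}
    (h : ∀ a, 0 < z a * σ a) : {x : ι → ℝ | ∀ a, 0 < x a * σ a} ∈ 𝓝 z :=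
  (eventually_all.2 fun a =>
    continuousAt_const.eventually_lt ((continuous_apply a).mul continuous_const).continuousAt (h a) :
    ∀ᶠ x in 𝓝 z, ∀ a, 0 < x a * σ a)

lemma exists_eigenvectors_joinMatrix {n1 n2 : ℕ} {G2 : SimpleGraph (Fin n2)}
    (hG2 : G2.Connected) {v : Fin n1} {w : Fin n2} {A1 : Matrix (Fin n1) (Fin n1) ℝ}
    {A2 : Matrix (Fin n2) (Fin n2) ℝ} (hA1 : A1.IsSymm) (hA2 : A2.IsSymm)
    (hA1v : ∀ a, a ≠ v → A1 a v < 0) (hstr2 : ∀ i j, G2.Adj i j → A2 i j ≠ 0)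
    (hneg1 : ∀ i j, A1 i j ≤ 0) (hneg2 : ∀ i j, A2 i j ≤ 0)
    {lam1 : Fin n1 → ℝ} {φ1 : Fin n1 → Fin n1 → ℝ} (hlam1 : Function.Injective lam1)
    (heig1 : ∀ k, A1 *ᵥ φ1 k = lam1 k • φ1 k) (hnv1 : ∀ k i, φ1 k i ≠ 0)
    {lam2 : Fin n2 → ℝ} {φ2 : Fin n2 → Fin n2 → ℝ} (hlam2 : Function.Injective lam2)
    (heig2 : ∀ k, A2 *ᵥ φ2 k = lam2 k • φ2 k) (hnv2 : ∀ k i, φ2 k i ≠ 0) :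
    ∃ s : ℝ, 0 < s ∧ ∀ᶠ ε in 𝓝[>] (0 : ℝ),
      ∃ (lam : Fin n1 ⊕ Fin n2 → ℝ) (φ : Fin n1 ⊕ Fin n2 → Fin n1 ⊕ Fin n2 → ℝ),
        Function.Injective lam ∧
        (∀ k, joinMatrix A1 A2 v w s ε *ᵥ φ k = lam k • φ k) ∧
        (∀ k x, φ k x ≠ 0) ∧
        (∀ i, nodalCountSym (joinMatrix A1 A2 v w s ε) (φ (Sum.inl i)) =
          nodalCount A1 (φ1 i)) ∧
        ∀ k, nodalCountSym (joinMatrix A1 A2 v w s ε) (φ (Sum.inr k)) =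
          nodalCount A2 (φ2 k) + n1 := by
  obtain ⟨c1, hc1⟩ := exists_sum_smul_eigenvectors_eq hlam1 heig1
    (fun k h => hnv1 k v (congrFun h v)) (Pi.single v 1)
  obtain ⟨c2, hc2⟩ := exists_sum_smul_eigenvectors_eq hlam2 heig2
    (fun k h => hnv2 k w (congrFun h w)) (Pi.single w 1)
  have hsub : ∀ x : ℝ, Tendsto (fun s => x - s) atTop atBot := fun x =>
    tendsto_atBot_add_const_left _ x tendsto_neg_atTop_atBot
  obtain ⟨s, hs0, hsep, hrow, hres⟩ : ∃ s : ℝ, 0 < s ∧ (∀ i k, lam1 i - s < lam2 k) ∧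
      (∀ i a, lam1 i - s < ∑ b, A2 a b) ∧
      ∀ k a, 0 < resolventVec lam1 φ1 c1 (lam2 k + s) a * (if a = v then -1 else 1) :=
    ((eventually_gt_atTop 0).and <|
      (eventually_all.2 fun i => eventually_all.2 fun k =>
        (hsub (lam1 i)).eventually_lt_atBot (lam2 k)).and <|
      (eventually_all.2 fun i => eventually_all.2 fun a =>
        (hsub (lam1 i)).eventually_lt_atBot (∑ b, A2 a b)).and <|
      eventually_all.2 fun k => (tendsto_atTop_add_const_left _ (lam2 k) tendsto_id).eventually
        (resolventVec_eventually_atTop heig1 hc1 hA1v)).exists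
  set e : Fin n1 ⊕ Fin n2 → ℝ := Sum.elim (fun i => lam1 i - s) lam2
  have heinj : Function.Injective e :=
    Function.Injective.sumElim (fun i j h => hlam1 (by simpa using h)) hlam2
      fun i k => (hsep i k).ne
  obtain ⟨δ, hδ, hδe⟩ := exists_pos_separation heinj
  have hshift : ∀ x : Fin n1 → ℝ, (A1 - s • (1 : Matrix _ _ ℝ)) *ᵥ x = A1 *ᵥ x - s • x := by
    intro x
    simp [Matrix.sub_mulVec, Matrix.smul_mulVec]
  have hR2 : ∀ i, ∀ᶠ μ in 𝓝 (lam1 i - s), ContinuousAt (resolventVec lam2 φ2 c2) μ ∧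
      A2 *ᵥ resolventVec lam2 φ2 c2 μ = μ • resolventVec lam2 φ2 c2 μ + Pi.single w 1 := fun i => by
    filter_upwards [eventually_forall_ne lam2 fun k => (hsep i k).ne'] with μ hμ
    exact ⟨continuousAt_resolventVec φ2 c2 hμ, mulVec_resolventVec heig2 hc2 hμ⟩
  have hR1 : ∀ k, ∀ᶠ μ in 𝓝 (lam2 k),
      ContinuousAt (fun μ => resolventVec lam1 φ1 c1 (μ + s)) μ ∧
      (A1 - s • (1 : Matrix _ _ ℝ)) *ᵥ resolventVec lam1 φ1 c1 (μ + s) =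
        μ • resolventVec lam1 φ1 c1 (μ + s) + Pi.single v 1 := fun k => by
    filter_upwards [eventually_forall_ne (fun i => lam1 i - s) fun i => (hsep i k).ne] with μ hμ
    have hμ' : ∀ j, lam1 j ≠ μ + s := fun j h => hμ j (by simp [h])
    refine ⟨ContinuousAt.comp (f := (· + s)) (continuousAt_resolventVec φ1 c1 hμ') (by fun_prop), ?_⟩
    rw [hshift, mulVec_resolventVec heig1 hc1 hμ', add_smul]
    abel
  have hself : ∀ {n : ℕ} {φ : Fin n → ℝ} (u : Fin n), (∀ a, φ a ≠ 0) →
      ∀ a, 0 < ((φ u)⁻¹ • φ) a * ((φ u)⁻¹ * φ a) := fun u hφ a =>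
    mul_self_pos.2 (mul_ne_zero (inv_ne_zero (hφ u)) (hφ a))
  have hpos : ∀ i a, 0 < resolventVec lam2 φ2 c2 (lam1 i - s) a * 1 := fun i a => by
    rw [mul_one]
    exact pos_of_mulVec_eq_smul_add_single hG2 hneg2 hstr2 (hrow i) (hR2 i).self_of_nhds.2 a
  have heig1' : ∀ i, (A1 - s • (1 : Matrix _ _ ℝ)) *ᵥ φ1 i = (lam1 i - s) • φ1 i := fun i => by
    rw [hshift, heig1, sub_smul]
  have hlam1' : Function.Injective fun i => lam1 i - s := fun i j h => hlam1 (by simpa using h)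
  have E1 := eventually_all.2 fun i => exists_coupled_eigenvector hlam1' heig1' hc1 (hnv1 i v)
    (hR2 i) hδ (setOf_forall_mul_pos_mem_nhds (hself v (hnv1 i)))
    (setOf_forall_mul_pos_mem_nhds (hpos i))
  have E2 := eventually_all.2 fun k => exists_coupled_eigenvector hlam2 heig2 hc2 (hnv2 k w)
    (hR1 k) hδ (setOf_forall_mul_pos_mem_nhds (hself w (hnv2 k)))
    (setOf_forall_mul_pos_mem_nhds (hres k))
  refine ⟨s, hs0, ?_⟩
  filter_upwards [E1, E2, self_mem_nhdsWithin] with ε h1 h2 (hε : 0 < ε)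
  choose μ1 x1 y1 hμ1 hx1 hy1 hx1v hB1 hC1 using h1
  choose μ2 x2 y2 hμ2 hx2 hy2 hx2w hB2 hC2 using h2
  simp only [mul_one] at hx1 hy1 hx2 hy2
  have hclose : ∀ a, |Sum.elim μ1 μ2 a - e a| < δ := by
    rintro (i | k)
    exacts [hμ1 i, hμ2 k]
  refine ⟨Sum.elim μ1 μ2, Sum.elim (fun i => Sum.elim (x1 i) (ε • y1 i))
    (fun k => Sum.elim (ε • y2 k) (x2 k)), ?_, ?_, ?_, ?_, ?_⟩
  · intro a b hab
    by_contra hne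
    have h3 := hδe a b hne
    have h4 := hclose a
    have h5 := hclose b
    rw [hab] at h4
    rw [abs_sub_comm] at h4
    linarith [abs_sub_le (e a) (Sum.elim μ1 μ2 b) (e b)]
  · rintro (i | k)
    · have hx : A1 *ᵥ x1 i - s • x1 i = _ := (hshift _).symm.trans (hB1 i)
      simp only [Sum.elim_inl, joinMatrix_mulVec_elim, hx, Matrix.mulVec_smul, hC1, hx1v]
      ext (a | a) <;> simp <;> ring
    · have hx : A1 *ᵥ y2 k - s • y2 k = _ := (hshift _).symm.trans (hC2 k)
      have hx' : A1 *ᵥ (ε • y2 k) - s • ε • y2 k = ε • (μ2 k • y2 k + Pi.single v 1) := by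
        rw [← hx, Matrix.mulVec_smul, smul_sub, smul_comm]
      simp only [Sum.elim_inr, joinMatrix_mulVec_elim, hx', hB2, hx2w]
      ext (a | a) <;> simp <;> ring
  · rintro (i | k) (a | a)
    · exact left_ne_zero_of_mul (hx1 i a).ne'
    · exact (mul_pos hε (hy1 i a)).ne'
    · exact mul_ne_zero hε.ne' (left_ne_zero_of_mul (hy2 k a).ne')
    · exact left_ne_zero_of_mul (hx2 k a).ne'
  · intro i
    have hy : ∀ a, 0 < (ε • y1 i) a := fun a => mul_pos hε (hy1 i a)
    rw [Sum.elim_inl, nodalCountSym_joinMatrix hA1 hA2 v w s hε, nodalCount_congr_sign (hx1 i),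
      nodalCount_eq_zero_of_pos hneg2 hy, hx1v, one_mul, if_neg (hy w).not_gt, add_zero, add_zero]
  · intro k
    have hy : ∀ a, 0 < (ε • y2 k) a * (if a = v then -1 else 1) := fun a => by
      simpa [mul_assoc] using mul_pos hε (hy2 k a)
    have hyv : (ε • y2 k) v < 0 := by simpa using hy v
    rw [Sum.elim_inr, nodalCountSym_joinMatrix hA1 hA2 v w s hε, nodalCount_congr_sign (hx2 k),
      hx2w, mul_one, if_pos hyv]
    have := nodalCount_add_one_of_neg_only_at hA1 hneg1 hA1v hy
    omega

end

/-- interpolation lemma.  Connecting two graphs by a weak edge, where the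
attaching vertex of `G1` has full degree, and both matrices satisfy the Nodal Count
Condition with non-positive entries, there is a shift `s` such that for all sufficiently
small `ε > 0` the block matrix `A_ε` is in `S(G)`, satisfies the Nodal Count Condition, and
has total nodal count `ν1 + ν2 + n1·n2`. -/
theorem interpolation_lemma {n1 n2 : ℕ}
    (G1 : SimpleGraph (Fin n1)) (G2 : SimpleGraph (Fin n2))
    (hG1 : G1.Connected) (hG2 : G2.Connected)
    (v : Fin n1) (w : Fin n2) (hv : ∀ a : Fin n1, a ≠ v → G1.Adj v a)
    (A1 : Matrix (Fin n1) (Fin n1) ℝ) (A2 : Matrix (Fin n2) (Fin n2) ℝ)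
    (hA1 : A1.IsSymm) (hA2 : A2.IsSymm)
    (hsupp1 : SupportedOn G1 A1) (hstr1 : ∀ i j, G1.Adj i j → A1 i j ≠ 0)
    (hsupp2 : SupportedOn G2 A2) (hstr2 : ∀ i j, G2.Adj i j → A2 i j ≠ 0)
    (hneg1 : ∀ i j, A1 i j ≤ 0) (hneg2 : ∀ i j, A2 i j ≤ 0)
    (lam1 : Fin n1 → ℝ) (φ1 : Fin n1 → Fin n1 → ℝ) (hlam1 : StrictMono lam1)
    (heig1 : ∀ k, A1.mulVec (φ1 k) = lam1 k • φ1 k) (hnv1 : ∀ k i, φ1 k i ≠ 0)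
    (lam2 : Fin n2 → ℝ) (φ2 : Fin n2 → Fin n2 → ℝ) (hlam2 : StrictMono lam2)
    (heig2 : ∀ k, A2.mulVec (φ2 k) = lam2 k • φ2 k) (hnv2 : ∀ k i, φ2 k i ≠ 0)
    (ν1 ν2 : ℕ)
    (hν1 : ∑ k, nodalCount A1 (φ1 k) = ν1) (hν2 : ∑ k, nodalCount A2 (φ2 k) = ν2) :
    ∃ s : ℝ, 0 < s ∧ ∃ ε0 : ℝ, 0 < ε0 ∧ ∀ ε : ℝ, 0 < ε → ε < ε0 →
      (joinMatrix A1 A2 v w s ε).IsSymm ∧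
      SupportedOn (joinGraph G1 G2 v w) (joinMatrix A1 A2 v w s ε) ∧
      (∀ x y, (joinGraph G1 G2 v w).Adj x y → joinMatrix A1 A2 v w s ε x y ≠ 0) ∧
      ∃ (lam : Fin (n1 + n2) → ℝ) (φ : Fin (n1 + n2) → Fin n1 ⊕ Fin n2 → ℝ),
        Function.Injective lam ∧
        (∀ k, (joinMatrix A1 A2 v w s ε).mulVec (φ k) = lam k • φ k) ∧
        (∀ k x, φ k x ≠ 0) ∧
        ∑ k, nodalCountSym (joinMatrix A1 A2 v w s ε) (φ k) = ν1 + ν2 + n1 * n2 := by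
  have hA1v : ∀ a, a ≠ v → A1 a v < 0 := fun a ha =>
    lt_of_le_of_ne (hneg1 a v) (hstr1 a v (hv a ha).symm)
  obtain ⟨s, hs, h⟩ := exists_eigenvectors_joinMatrix hG2 (w := w) hA1 hA2 hA1v hstr2 hneg1 hneg2
    hlam1.injective heig1 hnv1 hlam2.injective heig2 hnv2
  obtain ⟨ε0, hε0, h⟩ := mem_nhdsGT_iff_exists_Ioo_subset.1 h
  refine ⟨s, hs, ε0, hε0, fun ε hε hεlt => ⟨joinMatrix_isSymm hA1 hA2 v w s ε,
    joinMatrix_supportedOn hsupp1 hsupp2 v w s ε,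
    joinMatrix_ne_zero_of_adj hstr1 hstr2 v w s hε.ne', ?_⟩⟩
  obtain ⟨lam, φ, hinj, heig, hne, hl, hr⟩ := h ⟨hε, hεlt⟩
  refine ⟨lam ∘ finSumFinEquiv.symm, φ ∘ finSumFinEquiv.symm,
    hinj.comp finSumFinEquiv.symm.injective, fun k => heig _, fun k => hne _, ?_⟩
  simp only [Function.comp_apply]
  rw [finSumFinEquiv.symm.sum_comp fun k => nodalCountSym (joinMatrix A1 A2 v w s ε) (φ k),
    Fintype.sum_sum_type]
  simp only [hl, hr, Finset.sum_add_distrib, hν1, hν2, Finset.sum_const, Finset.card_univ,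
    Fintype.card_fin, smul_eq_mul]
  ring
end
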